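/- arXiv:1404.5164 — 2 statements merged into one kernel-verified Lean document; each statement's English description precedes it below -/
import Mathlib

section
/- Let r : S¹ → ℝ² be a C^∞ immersion with nonempty no-silhouette 𝒩𝒮_r and aperture angle θ_r, and suppose that r has no inflection points (its curvature never vanishes). Then for any θ₁, θ₂ with 0 ≤ θ₁ < θ₂ < θ_r, the inclusion 𝒩𝒮_{θ₁,r} ⊃ 𝒩𝒮_{θ₂,r} holds. -/
open Real

/-- Rotation of the plane by angle `θ`. -/
noncomputable def rot (θ : ℝ) (v : ℝ × ℝ) : ℝ × ℝ :=
  (v.1 * Real.cos θ - v.2 * Real.sin θ, v.1 * Real.sin θ + v.2 * Real.cos θ)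

/-- The set `𝒩𝒮_{θ,r}`: the complement of the union over `s` of the tangent
lines of `r` rotated by the angle `θ` about their points of tangency.
The circle `S¹` is modelled by `2π`-periodic maps `r : ℝ → ℝ × ℝ`. -/
noncomputable def NS (θ : ℝ) (r : ℝ → ℝ × ℝ) : Set (ℝ × ℝ) :=
  (⋃ s : ℝ, {P : ℝ × ℝ | ∃ t : ℝ, P = r s + t • rot θ (deriv r s)})ᶜ

/-- The cross product of two plane vectors. -/
def planeCross (u w : ℝ × ℝ) : ℝ := u.1 * w.2 - u.2 * w.1

/-- The Euclidean dot product of two plane vectors. -/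
def planeDot (u w : ℝ × ℝ) : ℝ := u.1 * w.1 + u.2 * w.2

lemma planeDot_self_pos {u : ℝ × ℝ} (hu : u ≠ 0) : 0 < planeDot u u := by
  unfold planeDot
  by_cases h : u.1 = 0
  · have h2 : u.2 ≠ 0 := fun h2 => hu (Prod.ext h h2)
    exact add_pos_of_nonneg_of_pos (mul_self_nonneg _) (mul_self_pos.2 h2)
  · exact add_pos_of_pos_of_nonneg (mul_self_pos.2 h) (mul_self_nonneg _)

/-- For `u ≠ 0`, a vector is a multiple of `rot θ u` iff its cross product with it vanishes. -/
lemma exists_eq_smul_rot_iff {u : ℝ × ℝ} (hu : u ≠ 0) (w : ℝ × ℝ) (θ : ℝ) :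
    (∃ t : ℝ, w = t • rot θ u) ↔ planeCross u w * cos θ - planeDot u w * sin θ = 0 := by
  have hpos := planeDot_self_pos hu
  have hcs := sin_sq_add_cos_sq θ
  constructor
  · rintro ⟨t, rfl⟩
    simp only [rot, planeCross, planeDot, Prod.smul_fst, Prod.smul_snd, smul_eq_mul]
    ring
  · intro h
    refine ⟨(planeDot u w * cos θ + planeCross u w * sin θ) / planeDot u u, ?_⟩
    ext <;> simp only [rot, Prod.smul_fst, Prod.smul_snd, smul_eq_mul] <;>
      rw [div_mul_eq_mul_div, eq_div_iff hpos.ne'] <;>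
      simp only [planeCross, planeDot] at h ⊢
    · linear_combination -(u.1 * sin θ + u.2 * cos θ) * h
        - w.1 * (u.1 ^ 2 + u.2 ^ 2) * hcs
    · linear_combination (u.1 * cos θ - u.2 * sin θ) * h
        - w.2 * (u.1 ^ 2 + u.2 ^ 2) * hcs

lemma mem_NS_iff {r : ℝ → ℝ × ℝ} (himm : ∀ s, deriv r s ≠ 0) (θ : ℝ) (P : ℝ × ℝ) :
    P ∈ NS θ r ↔ ∀ s, planeCross (deriv r s) (P - r s) * cos θ
      - planeDot (deriv r s) (P - r s) * sin θ ≠ 0 := by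
  simp only [NS, Set.mem_compl_iff, Set.mem_iUnion, Set.mem_ofPred_eq, not_exists, ne_eq,
    ← exists_eq_smul_rot_iff (himm _), sub_eq_iff_eq_add']

/-- A nowhere vanishing continuous function on the line has constant sign. -/
lemma forall_pos_or_forall_neg_of_continuous {f : ℝ → ℝ} (hf : Continuous f)
    (h0 : ∀ s, f s ≠ 0) : (∀ s, 0 < f s) ∨ ∀ s, f s < 0 := by
  by_contra! ⟨⟨a, ha⟩, b, hb⟩
  obtain ⟨c, hc⟩ := mem_range_of_exists_le_of_exists_ge hf ⟨a, ha⟩ ⟨b, hb⟩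
  exact h0 c hc

/-- A periodic function whose derivative is positive at each of its zeros has no zeros. -/
lemma Function.Periodic.ne_zero_of_deriv_pos {f f' : ℝ → ℝ} {T : ℝ} (hT : 0 < T)
    (hper : Function.Periodic f T) (hf : ∀ s, HasDerivAt f (f' s) s)
    (hpos : ∀ s, f s = 0 → 0 < f' s) (s : ℝ) : f s ≠ 0 := by
  intro hs
  have hnonneg : ∀ x ∈ Set.Icc s (s + 2 * T), 0 ≤ f x := by
    intro x hx
    have hcont : Continuous f := continuous_iff_continuousAt.2 fun x => (hf x).continuousAt
    have := image_le_of_deriv_right_lt_deriv_boundary (f := fun x => -f x)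
      (f' := fun x => -f' x) (B := fun _ => 0) (B' := fun _ => 0) (a := s) (b := s + 2 * T)
      hcont.neg.continuousOn (fun x _ => (hf x).neg.hasDerivWithinAt) (by simp [hs])
      (fun x => hasDerivAt_const x 0)
      (fun x _ hx => neg_lt_zero.2 (hpos x (neg_eq_zero.1 hx))) hx
    linarith
  have hsT : f (s + T) = 0 := by rw [hper, hs]
  have hmin : IsLocalMin f (s + T) := by
    filter_upwards [Icc_mem_nhds (show s < s + T by linarith)
      (show s + T < s + 2 * T by linarith)] with x hx
    rw [hsT]
    exact hnonneg x hx
  exact (hpos _ hsT).ne' (hmin.hasDerivAt_eq_zero (hf _))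

/-- The derivative of a periodic differentiable function vanishes somewhere. -/
lemma Function.Periodic.exists_hasDerivAt_eq_zero {f f' : ℝ → ℝ} {T : ℝ} (hT : 0 < T)
    (hper : Function.Periodic f T) (hf : ∀ s, HasDerivAt f (f' s) s) : ∃ s, f' s = 0 := by
  obtain ⟨c, -, hc⟩ := _root_.exists_hasDerivAt_eq_zero (f := f) (f' := f') hT
    (fun x _ => (hf x).continuousAt.continuousWithinAt) (by simpa using (hper 0).symm)
    (fun x _ => hf x)
  exact ⟨c, hc⟩

lemma HasDerivAt.fst_comp {u : ℝ → ℝ × ℝ} {u' : ℝ × ℝ} {s : ℝ} (hu : HasDerivAt u u' s) :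
    HasDerivAt (fun s => (u s).1) u'.1 s :=
  (hasFDerivAt_fst (𝕜 := ℝ) (E := ℝ) (F := ℝ) (p := u s)).comp_hasDerivAt s hu

lemma HasDerivAt.snd_comp {u : ℝ → ℝ × ℝ} {u' : ℝ × ℝ} {s : ℝ} (hu : HasDerivAt u u' s) :
    HasDerivAt (fun s => (u s).2) u'.2 s :=
  (hasFDerivAt_snd (𝕜 := ℝ) (E := ℝ) (F := ℝ) (p := u s)).comp_hasDerivAt s hu

lemma hasDerivAt_planeCross {u w : ℝ → ℝ × ℝ} {u' w' : ℝ × ℝ} {s : ℝ} (hu : HasDerivAt u u' s)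
    (hw : HasDerivAt w w' s) :
    HasDerivAt (fun s => planeCross (u s) (w s))
      (planeCross u' (w s) + planeCross (u s) w') s := by
  have h := (hu.fst_comp.mul hw.snd_comp).sub
    (hu.snd_comp.mul hw.fst_comp)
  refine h.congr_deriv ?_
  simp only [planeCross]
  ring

lemma hasDerivAt_planeDot {u w : ℝ → ℝ × ℝ} {u' w' : ℝ × ℝ} {s : ℝ} (hu : HasDerivAt u u' s)
    (hw : HasDerivAt w w' s) :
    HasDerivAt (fun s => planeDot (u s) (w s))
      (planeDot u' (w s) + planeDot (u s) w') s := by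
  have h := (hu.fst_comp.mul hw.fst_comp).add
    (hu.snd_comp.mul hw.snd_comp)
  refine h.congr_deriv ?_
  simp only [planeDot]
  ring

/-- Let `r` be a `C^∞` immersion of `S¹` in the plane with nonempty
no-silhouette and aperture angle `θr`, and suppose `r` has no inflection
points, i.e. its signed curvature (equivalently `det(r', r'')`) never
vanishes.  Then `𝒩𝒮_{θ₂,r} ⊆ 𝒩𝒮_{θ₁,r}` whenever `0 ≤ θ₁ < θ₂ < θr`. -/
theorem NS_antitone_of_no_inflection (r : ℝ → ℝ × ℝ)
    (hsmooth : ContDiff ℝ (⊤ : ℕ∞) r) (hper : Function.Periodic r (2 * π))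
    (himm : ∀ s : ℝ, deriv r s ≠ 0)
    (hNS : (NS 0 r).Nonempty)
    (θr : ℝ) (hθr0 : 0 < θr) (hθr1 : θr ≤ π / 2)
    (haperture : ∀ θ : ℝ, 0 ≤ θ → θ < θr → (NS θ r).Nonempty)
    (hlargest : ∀ a : ℝ, (∀ θ : ℝ, 0 ≤ θ → θ < a → (NS θ r).Nonempty) → a ≤ θr)
    (hnoinfl : ∀ s : ℝ,
      (deriv r s).1 * (deriv (deriv r) s).2 - (deriv r s).2 * (deriv (deriv r) s).1 ≠ 0)
    (θ₁ θ₂ : ℝ) (h01 : 0 ≤ θ₁) (h12 : θ₁ < θ₂) (h2r : θ₂ < θr) :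
    NS θ₂ r ⊆ NS θ₁ r := by
  intro P hP
  rw [mem_NS_iff himm] at hP ⊢
  have h2pos : 0 < sin θ₂ := sin_pos_of_pos_of_lt_pi (by linarith) (by linarith [pi_pos])
  have h2cos : 0 < cos θ₂ := cos_pos_of_mem_Ioo ⟨by linarith [pi_pos], by linarith⟩
  have hr' : ContDiff ℝ (⊤ : ℕ∞) (deriv r) := (contDiff_infty_iff_deriv.1 hsmooth).2
  have hr'' : ContDiff ℝ (⊤ : ℕ∞) (deriv (deriv r)) := (contDiff_infty_iff_deriv.1 hr').2
  have hu (s : ℝ) : HasDerivAt (deriv r) (deriv (deriv r) s) s :=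
    (hr'.differentiable (by simp) s).hasDerivAt
  have hw (s : ℝ) : HasDerivAt (fun s => P - r s) (-deriv r s) s :=
    (hsmooth.differentiable (by simp) s).hasDerivAt.const_sub P
  have huper : Function.Periodic (deriv r) (2 * π) := fun s => by
    rw [← deriv_comp_add_const]
    exact congrArg (fun f => deriv f s) (funext hper)
  set C : ℝ → ℝ := fun s => planeCross (deriv r s) (P - r s) with hC
  set D : ℝ → ℝ := fun s => planeDot (deriv r s) (P - r s) with hD
  set g : ℝ → ℝ := fun s => C s * cos θ₂ - D s * sin θ₂ with hg
  have hCd (s : ℝ) : HasDerivAt C (planeCross (deriv (deriv r) s) (P - r s)) s := by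
    refine (hasDerivAt_planeCross (hu s) (hw s)).congr_deriv ?_
    simp only [planeCross, Prod.fst_neg, Prod.snd_neg]
    ring
  have hCc : Continuous C := continuous_iff_continuousAt.2 fun s => (hCd s).continuousAt
  have hDc : Continuous D :=
    continuous_iff_continuousAt.2 fun s => (hasDerivAt_planeDot (hu s) (hw s)).continuousAt
  have hgc : Continuous g := by fun_prop
  have hCper : Function.Periodic C (2 * π) := fun s => by simp only [hC, huper s, hper s]
  have hK : Continuous fun s => planeCross (deriv r s) (deriv (deriv r) s) := by
    unfold planeCross
    have := hr'.continuous
    have := hr''.continuous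
    fun_prop
  have hCzero (s : ℝ) (hs : C s = 0) :
      planeDot (deriv r s) (deriv r s) * sin θ₂ * planeCross (deriv (deriv r) s) (P - r s)
        = g s * planeCross (deriv r s) (deriv (deriv r) s) := by
    simp only [hg, hs]
    simp only [hC, hD, planeCross, planeDot] at hs ⊢
    linear_combination sin θ₂ * ((deriv (deriv r) s).1 * (deriv r s).1
      + (deriv (deriv r) s).2 * (deriv r s).2) * hs
  have hC0 (s : ℝ) : C s ≠ 0 := by
    have hden (s : ℝ) : 0 < planeDot (deriv r s) (deriv r s) * sin θ₂ :=
      mul_pos (planeDot_self_pos (himm s)) h2pos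
    rcases forall_pos_or_forall_neg_of_continuous (hgc.mul hK)
      (fun s => mul_ne_zero (hP s) (hnoinfl s)) with h | h
    · refine hCper.ne_zero_of_deriv_pos two_pi_pos hCd (fun s hs => ?_) s
      exact pos_of_mul_pos_right ((h s).trans_eq (hCzero s hs).symm) (hden s).le
    · have := Function.Periodic.ne_zero_of_deriv_pos (f := fun s => -C s) two_pi_pos
        (fun s => congrArg Neg.neg (hCper s)) (fun s => (hCd s).neg) (fun s hs => ?_) s
      · simpa using this
      · rw [neg_pos]
        exact neg_of_mul_neg_right ((hCzero s (neg_eq_zero.1 hs)).trans_lt (h s)) (hden s).le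
  intro s₀ hs₀
  change C s₀ * cos θ₁ - D s₀ * sin θ₁ = 0 at hs₀
  have h1pos : 0 < sin θ₁ := by
    rcases h01.eq_or_lt with rfl | h
    · simp [hC0] at hs₀
    · exact sin_pos_of_pos_of_lt_pi h (by linarith [pi_pos])
  have hsub : 0 < sin (θ₂ - θ₁) :=
    sin_pos_of_pos_of_lt_pi (by linarith) (by linarith [pi_pos])
  have hgC : g s₀ * sin θ₁ = -(C s₀ * sin (θ₂ - θ₁)) := by
    rw [sin_sub]
    simp only [hg]
    linear_combination sin θ₂ * hs₀
  have hgCneg (s : ℝ) : g s * C s < 0 := by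
    rcases forall_pos_or_forall_neg_of_continuous (hgc.mul hCc)
      (fun s => mul_ne_zero (hP s) (hC0 s)) with h | h
    · have h1 : 0 < g s₀ * C s₀ * sin θ₁ := mul_pos (h s₀) h1pos
      have h2 := mul_pos (sq_pos_of_ne_zero (hC0 s₀)) hsub
      have h3 : g s₀ * C s₀ * sin θ₁ = -(C s₀ ^ 2 * sin (θ₂ - θ₁)) := by
        linear_combination C s₀ * hgC
      linarith
    · exact h s
  have hD0 (s : ℝ) : D s ≠ 0 := fun h => by
    have h1 := hgCneg s
    simp only [hg, h] at h1
    nlinarith [mul_pos (sq_pos_of_ne_zero (hC0 s)) h2cos]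
  obtain ⟨c, hc⟩ := Function.Periodic.exists_hasDerivAt_eq_zero
    (f := fun s => planeDot (P - r s) (P - r s)) two_pi_pos
    (fun s => by simp only [hper s]) (fun s => hasDerivAt_planeDot (hw s) (hw s))
  refine hD0 c ?_
  simp only [hD, planeDot, Prod.fst_neg, Prod.snd_neg] at hc ⊢
  linarith
end

section
/- Let h : S¹ → ℝ₊ be a function of class C¹. Then the Wulff shape 𝒲_h is never a polygon. -/
open Real

/-- The Wulff shape associated with a support function `h` on `S¹`, the circle
being parametrised by angle: `𝒲_h = ⋂_{λ} {P | P ⬝ (cos λ, sin λ) ≤ h λ}`. -/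
noncomputable def Wulff (h : ℝ → ℝ) : Set (ℝ × ℝ) :=
  ⋂ lam : ℝ, {P : ℝ × ℝ | P.1 * Real.cos lam + P.2 * Real.sin lam ≤ h lam}

/-- A polygon: a compact plane region whose boundary is a finite union of
line segments. -/
def IsPolygon (K : Set (ℝ × ℝ)) : Prop :=
  IsCompact K ∧ ∃ F : Finset ((ℝ × ℝ) × (ℝ × ℝ)),
    frontier K = ⋃ p ∈ F, segment ℝ p.1 p.2

theorem isClosed_Wulff (h : ℝ → ℝ) : IsClosed (Wulff h) :=
  isClosed_iInter fun _ => isClosed_le (by fun_prop) continuous_const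

theorem mem_Wulff {h : ℝ → ℝ} {P : ℝ × ℝ} :
    P ∈ Wulff h ↔ ∀ lam : ℝ, P.1 * Real.cos lam + P.2 * Real.sin lam ≤ h lam := by
  simp [Wulff]

/-- Every boundary point of a Wulff shape lies on one of its supporting lines. -/
theorem exists_eq_of_mem_frontier_Wulff {h : ℝ → ℝ} (hcont : Continuous h)
    (hperiodic : Function.Periodic h (2 * π)) {P : ℝ × ℝ} (hP : P ∈ frontier (Wulff h)) :
    ∃ lam : ℝ, P.1 * Real.cos lam + P.2 * Real.sin lam = h lam := by
  by_contra! hne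
  have hPK := mem_Wulff.1 ((isClosed_Wulff h).frontier_subset hP)
  have hev : ∀ᶠ Q : ℝ × ℝ in nhds P, ∀ lam ∈ Set.Icc 0 (2 * π),
      Q.1 * Real.cos lam + Q.2 * Real.sin lam < h lam := by
    refine isCompact_Icc.eventually_forall_of_forall_eventually fun lam _ => ?_
    exact ContinuousAt.eventually_lt
      (f := fun z : (ℝ × ℝ) × ℝ => z.1.1 * Real.cos z.2 + z.1.2 * Real.sin z.2)
      (g := fun z => h z.2) (by fun_prop) (by fun_prop) ((hPK lam).lt_of_ne (hne lam))
  refine hP.2 (mem_interior_iff_mem_nhds.2 ?_)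
  filter_upwards [hev] with Q hQ
  refine mem_Wulff.2 fun lam => ?_
  have hper : Function.Periodic
      (fun t => h t - (Q.1 * Real.cos t + Q.2 * Real.sin t)) (2 * π) := fun t => by
    simp [hperiodic t]
  obtain ⟨t, ht, hlt⟩ := hper.exists_mem_Ico₀ Real.two_pi_pos lam
  have := hQ t (Set.Ico_subset_Icc_self ht)
  linarith

/-- A supporting line of the Wulff shape of a differentiable function determines the angular
derivative of `h` at each point of contact. -/
theorem deriv_eq_of_mem_Wulff {h : ℝ → ℝ} {lam : ℝ} (hd : DifferentiableAt ℝ h lam)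
    {P : ℝ × ℝ} (hP : P ∈ Wulff h)
    (heq : P.1 * Real.cos lam + P.2 * Real.sin lam = h lam) :
    deriv h lam = P.1 * -Real.sin lam + P.2 * Real.cos lam := by
  have hmin : IsLocalMin (fun t => h t - (P.1 * Real.cos t + P.2 * Real.sin t)) lam :=
    Filter.Eventually.of_forall fun t => by
      have := mem_Wulff.1 hP t
      simp only
      linarith
  have := hmin.hasDerivAt_eq_zero (hd.hasDerivAt.sub
    (((Real.hasDerivAt_cos lam).const_mul P.1).add ((Real.hasDerivAt_sin lam).const_mul P.2)))
  linarith

/-- A supporting line touches the Wulff shape of a differentiable function at most once. -/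
theorem eq_of_mem_Wulff {h : ℝ → ℝ} {lam : ℝ} (hd : DifferentiableAt ℝ h lam)
    {P Q : ℝ × ℝ} (hP : P ∈ Wulff h) (hQ : Q ∈ Wulff h)
    (hPeq : P.1 * Real.cos lam + P.2 * Real.sin lam = h lam)
    (hQeq : Q.1 * Real.cos lam + Q.2 * Real.sin lam = h lam) : P = Q := by
  have hP' := deriv_eq_of_mem_Wulff hd hP hPeq
  have hQ' := deriv_eq_of_mem_Wulff hd hQ hQeq
  have hsc := Real.sin_sq_add_cos_sq lam
  rw [hP'] at hQ'
  rw [← hPeq] at hQeq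
  ext
  · linear_combination (Q.1 - P.1) * hsc - Real.cos lam * hQeq - Real.sin lam * hQ'
  · linear_combination (Q.2 - P.2) * hsc - Real.sin lam * hQeq + Real.cos lam * hQ'

theorem infinite_frontier_Wulff {h : ℝ → ℝ} (hcont : Continuous h)
    (hperiodic : Function.Periodic h (2 * π)) (hpos : ∀ lam : ℝ, 0 < h lam) :
    (frontier (Wulff h)).Infinite := by
  intro hfin
  have hrank : 1 < Module.rank ℝ (ℝ × ℝ) := by
    rw [← Module.finrank_eq_rank]
    simp
  have hconn := (hfin.countable.isPathConnected_compl_of_one_lt_rank hrank).isConnected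
  have hzero : (0 : ℝ × ℝ) ∉ frontier (Wulff h) := fun h0 => by
    obtain ⟨lam, hlam⟩ := exists_eq_of_mem_frontier_Wulff hcont hperiodic h0
    simp only [Prod.fst_zero, Prod.snd_zero, zero_mul, add_zero] at hlam
    exact (hpos lam).ne hlam
  have hout : ((h 0 + 1, 0) : ℝ × ℝ) ∉ Wulff h := fun hmem => by
    have := mem_Wulff.1 hmem 0
    simp at this
    linarith
  have hint : ∀ x ∉ frontier (Wulff h), x ∈ Wulff h → x ∈ interior (Wulff h) :=
    fun x hx hxK => by_contra fun hni => hx ⟨subset_closure hxK, hni⟩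
  obtain ⟨x, -, hxi, hxc⟩ := hconn.isPreconnected (interior (Wulff h)) (Wulff h)ᶜ
    isOpen_interior (isClosed_Wulff h).isOpen_compl
    (fun x hx => (em (x ∈ Wulff h)).imp_left (hint x hx))
    ⟨0, hzero, hint 0 hzero (mem_Wulff.2 fun lam => by simpa using (hpos lam).le)⟩
    ⟨_, fun hfr => hout ((isClosed_Wulff h).frontier_subset hfr), hout⟩
  exact hxc (interior_subset hxi)

/-- The boundary of the Wulff shape of a differentiable periodic function contains no
nondegenerate segment. -/
theorem eq_of_segment_subset_frontier_Wulff {h : ℝ → ℝ} (hd : Differentiable ℝ h)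
    (hperiodic : Function.Periodic h (2 * π)) {P Q : ℝ × ℝ}
    (hseg : segment ℝ P Q ⊆ frontier (Wulff h)) : P = Q := by
  have hsub := hseg.trans (isClosed_Wulff h).frontier_subset
  have hP := hsub (left_mem_segment ℝ P Q)
  have hQ := hsub (right_mem_segment ℝ P Q)
  have hmid : (1 / 2 : ℝ) • P + (1 / 2 : ℝ) • Q ∈ segment ℝ P Q :=
    ⟨1 / 2, 1 / 2, by norm_num, by norm_num, by norm_num, rfl⟩
  obtain ⟨lam, hlam⟩ := exists_eq_of_mem_frontier_Wulff hd.continuous hperiodic (hseg hmid)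
  simp only [Prod.fst_add, Prod.snd_add, Prod.smul_fst, Prod.smul_snd, smul_eq_mul] at hlam
  have hPle := mem_Wulff.1 hP lam
  have hQle := mem_Wulff.1 hQ lam
  exact eq_of_mem_Wulff (hd lam) hP hQ (by linarith) (by linarith)

/-- If the support function `h : S¹ → ℝ₊` is of class `C¹`, then the Wulff
shape `𝒲_h` is never a polygon. -/
theorem wulff_of_C1_not_polygon (h : ℝ → ℝ)
    (hC1 : ContDiff ℝ 1 h) (hperiodic : Function.Periodic h (2 * π))
    (hpos : ∀ lam : ℝ, 0 < h lam) :
    ¬ IsPolygon (Wulff h) := by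
  rintro ⟨-, F, hF⟩
  have hd : Differentiable ℝ h := hC1.differentiable (by norm_num)
  refine infinite_frontier_Wulff hd.continuous hperiodic hpos ?_
  rw [hF]
  refine F.finite_toSet.biUnion fun p hp => ?_
  have hseg : segment ℝ p.1 p.2 ⊆ frontier (Wulff h) := by
    rw [hF]
    exact Set.subset_biUnion_of_mem (u := fun p : (ℝ × ℝ) × (ℝ × ℝ) => segment ℝ p.1 p.2) hp
  rw [eq_of_segment_subset_frontier_Wulff hd hperiodic hseg, segment_same]
  exact Set.finite_singleton _
end
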